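/- Equality case of the discrete best-response variational inequality (used in Step 3 of the proof of Theorem 3.2). Let m⁰ : Ω_h → ℝ satisfy m⁰_j ≥ 0 for all j and m⁰_j = 0 for every boundary point j. Let g : {0,...,K−1} × Ω_h → ℝ, let u solve the implicit discrete obstacle problem with source g, and let m' : {0,...,K} × Ω_h → ℝ satisfy m'^0 = m⁰, m'^k_j = 0 for every boundary j, and for every k ∈ {1,...,K} and interior j: (m'^k_j − m'^{k−1}_j)/τ − Δ_h m'^k(j) = 0 whenever u^k_j < 0, and m'^k_j = 0 whenever u^k_j = 0. If m ∈ T_{h,τ} and Σ_{k=0}^{K−1} Σ_{j interior} g^k_j (m'^k_j − m^k_j) = 0, then m^k_j = m'^k_j for every (j,k) ∈ Γ(u) (with Γ(u) taken with source g), and (m^k_j − m^{k−1}_j)/τ − Δ_h m^k(j) = 0 for every k ∈ {1,...,K} and interior j with u^k_j < 0. -/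

import Mathlib

/-- `j` is a grid point of `Ω_h = {0,…,N}^d`. -/
def isGridPt (N : ℕ) {d : ℕ} (j : Fin d → ℤ) : Prop :=
  ∀ i : Fin d, 0 ≤ j i ∧ j i ≤ (N : ℤ)

/-- `j` is an interior grid point: every coordinate lies in `{1,…,N−1}`. -/
def isInterior (N : ℕ) {d : ℕ} (j : Fin d → ℤ) : Prop :=
  ∀ i : Fin d, 1 ≤ j i ∧ j i ≤ (N : ℤ) - 1

/-- `j` is a boundary point of the grid. -/
def isBoundary (N : ℕ) {d : ℕ} (j : Fin d → ℤ) : Prop :=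
  isGridPt N j ∧ ¬ isInterior N j

/-- The finite set of interior grid points. -/
noncomputable def intPts (N d : ℕ) : Finset (Fin d → ℤ) :=
  Fintype.piFinset fun _ : Fin d => Finset.Icc (1 : ℤ) ((N : ℤ) - 1)

/-- Discrete Laplacian with mesh size `h`:
`Δ_h v (j) = h⁻² Σᵢ (v(j+eᵢ) − 2v(j) + v(j−eᵢ))`. -/
noncomputable def discLap (h : ℝ) {d : ℕ} (v : (Fin d → ℤ) → ℝ) (j : Fin d → ℤ) : ℝ :=
  (1 / h ^ 2) * ∑ i : Fin d, (v (j + Pi.single i 1) - 2 * v j + v (j - Pi.single i 1))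

/-- `u` solves the implicit discrete obstacle problem with source `f`:
`max((u^k_j − u^{k+1}_j)/τ − Δ_h u^k(j) − f^k_j, u^k_j) = 0` at interior points for `k < K`,
with `u^K = 0` on the grid and `u^k = 0` on the boundary. -/
def solvesObstacle (N K : ℕ) (τ h : ℝ) {d : ℕ}
    (f : ℕ → (Fin d → ℤ) → ℝ) (u : ℕ → (Fin d → ℤ) → ℝ) : Prop :=
  (∀ k < K, ∀ j : Fin d → ℤ, isInterior N j →
      max ((u k j - u (k + 1) j) / τ - discLap h (u k) j - f k j) (u k j) = 0) ∧
  (∀ j : Fin d → ℤ, isGridPt N j → u K j = 0) ∧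
  (∀ k < K, ∀ j : Fin d → ℤ, isBoundary N j → u k j = 0)

/-- Membership in the discrete test set `T_{h,τ}` with initial datum `m⁰`. -/
def inTestSet (N K : ℕ) (τ h : ℝ) {d : ℕ} (m0 : (Fin d → ℤ) → ℝ)
    (m : ℕ → (Fin d → ℤ) → ℝ) : Prop :=
  (∀ k ≤ K, ∀ j : Fin d → ℤ, isBoundary N j → m k j = 0) ∧
  (∀ k ≤ K, ∀ j : Fin d → ℤ, isGridPt N j → 0 ≤ m k j) ∧
  (∀ k, 1 ≤ k → k ≤ K → ∀ j : Fin d → ℤ, isInterior N j →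
      (m k j - m (k - 1) j) / τ - discLap h (m k) j ≤ 0) ∧
  (∀ j : Fin d → ℤ, isGridPt N j → m 0 j = m0 j)

theorem mem_intPts' (N d : ℕ) (j : Fin d → ℤ) : j ∈ intPts N d ↔ isInterior N j := by
  simp [intPts, isInterior, Fintype.mem_piFinset]

theorem sum_shift {d : ℕ} (S : Finset (Fin d → ℤ)) (a b : (Fin d → ℤ) → ℝ)
    (ha : ∀ j ∉ S, a j = 0) (hb : ∀ j ∉ S, b j = 0) (e : Fin d → ℤ) :
    ∑ j ∈ S, a (j + e) * b j = ∑ j ∈ S, a j * b (j - e) := by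
  rw [← tsum_eq_sum (L := .unconditional _) (s := S) (f := fun j => a (j + e) * b j)
      (fun j hj => by simp [hb j hj]),
    ← tsum_eq_sum (L := .unconditional _) (s := S) (f := fun j => a j * b (j - e))
      (fun j hj => by simp [ha j hj]),
    ← Equiv.tsum_eq (Equiv.addRight e) (fun j => a j * b (j - e))]
  simp

theorem green0 {d : ℕ} (S : Finset (Fin d → ℤ)) (h : ℝ) (a b : (Fin d → ℤ) → ℝ)
    (ha : ∀ j ∉ S, a j = 0) (hb : ∀ j ∉ S, b j = 0) :
    ∑ j ∈ S, discLap h a j * b j = ∑ j ∈ S, a j * discLap h b j := by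
  have key : ∀ i : Fin d, ∑ j ∈ S, (a (j + Pi.single i 1) - 2 * a j + a (j - Pi.single i 1)) * b j
      = ∑ j ∈ S, a j * (b (j + Pi.single i 1) - 2 * b j + b (j - Pi.single i 1)) := by
    intro i
    have h1 := sum_shift S a b ha hb (Pi.single i 1)
    have h2 := sum_shift S b a hb ha (Pi.single i 1)
    have e1 : ∑ j ∈ S, (a (j + Pi.single i 1) - 2 * a j + a (j - Pi.single i 1)) * b j
      = ∑ j ∈ S, a (j + Pi.single i 1) * b j - ∑ j ∈ S, 2 * (a j * b j)
        + ∑ j ∈ S, b j * a (j - Pi.single i 1) := by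
      rw [← Finset.sum_sub_distrib, ← Finset.sum_add_distrib]
      exact Finset.sum_congr rfl fun j _ => by ring
    have e2 : ∑ j ∈ S, a j * (b (j + Pi.single i 1) - 2 * b j + b (j - Pi.single i 1))
      = ∑ j ∈ S, b (j + Pi.single i 1) * a j - ∑ j ∈ S, 2 * (a j * b j)
        + ∑ j ∈ S, a j * b (j - Pi.single i 1) := by
      rw [← Finset.sum_sub_distrib, ← Finset.sum_add_distrib]
      exact Finset.sum_congr rfl fun j _ => by ring
    rw [e1, e2, h1, h2]; ring
  have l : ∀ j, discLap h a j * b j = ∑ i : Fin d, (1 / h ^ 2) *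
      ((a (j + Pi.single i 1) - 2 * a j + a (j - Pi.single i 1)) * b j) := by
    intro j
    rw [discLap, Finset.mul_sum, Finset.sum_mul]
    exact Finset.sum_congr rfl fun j _ => by ring
  have r : ∀ j, a j * discLap h b j = ∑ i : Fin d, (1 / h ^ 2) *
      (a j * (b (j + Pi.single i 1) - 2 * b j + b (j - Pi.single i 1))) := by
    intro j
    rw [discLap, Finset.mul_sum, Finset.mul_sum]
    exact Finset.sum_congr rfl fun j _ => by ring
  simp only [l, r]
  rw [Finset.sum_comm, Finset.sum_comm (s := S)]
  refine Finset.sum_congr rfl fun i _ => ?_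
  rw [← Finset.mul_sum, ← Finset.mul_sum, key i]

theorem interior_grid {N d : ℕ} {j : Fin d → ℤ} (hj : isInterior N j) : isGridPt N j := by
  intro i; have := hj i; constructor <;> linarith [this.1, this.2]

theorem interior_add {N d : ℕ} {j : Fin d → ℤ} (hj : isInterior N j) (i : Fin d) :
    isGridPt N (j + Pi.single i 1) := by
  intro l; have := hj l
  by_cases hl : l = i
  · subst hl; simp; omega
  · simp [hl]; omega

theorem interior_sub {N d : ℕ} {j : Fin d → ℤ} (hj : isInterior N j) (i : Fin d) :
    isGridPt N (j - Pi.single i 1) := by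
  intro l; have := hj l
  by_cases hl : l = i
  · subst hl; simp; omega
  · simp [hl]; omega

theorem lap_congr {N d : ℕ} (h : ℝ) {a b : (Fin d → ℤ) → ℝ}
    (hab : ∀ j, isGridPt N j → a j = b j) {j : Fin d → ℤ} (hj : isInterior N j) :
    discLap h a j = discLap h b j := by
  unfold discLap
  congr 1
  refine Finset.sum_congr rfl fun i _ => ?_
  rw [hab _ (interior_add hj i), hab _ (interior_sub hj i), hab _ (interior_grid hj)]

theorem lap_sub {d : ℕ} (h : ℝ) (a b : (Fin d → ℤ) → ℝ) (j : Fin d → ℤ) :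
    discLap h (fun j => a j - b j) j = discLap h a j - discLap h b j := by
  unfold discLap
  rw [← mul_sub, ← Finset.sum_sub_distrib]
  congr 1
  exact Finset.sum_congr rfl fun i _ => by ring

theorem green {N d : ℕ} (h : ℝ) (a b : (Fin d → ℤ) → ℝ)
    (ha : ∀ j, isBoundary N j → a j = 0) (hb : ∀ j, isBoundary N j → b j = 0) :
    ∑ j ∈ intPts N d, discLap h a j * b j = ∑ j ∈ intPts N d, a j * discLap h b j := by
  classical
  let E : ((Fin d → ℤ) → ℝ) → (Fin d → ℤ) → ℝ := fun v j => if j ∈ intPts N d then v j else 0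
  have hE : ∀ v : (Fin d → ℤ) → ℝ, (∀ j, isBoundary N j → v j = 0) →
      ∀ j, isGridPt N j → v j = E v j := by
    intro v hv j hj
    by_cases hi : j ∈ intPts N d
    · simp [E, hi]
    · simp only [E, hi, if_false]
      exact hv j ⟨hj, fun h => hi ((mem_intPts' N d j).2 h)⟩
  have h0 : ∀ v, ∀ j ∉ intPts N d, E v j = 0 := fun v j hj => by simp [E, hj]
  have := green0 (intPts N d) h (E a) (E b) (h0 a) (h0 b)
  calc _ = ∑ j ∈ intPts N d, discLap h (E a) j * E b j := by
        refine Finset.sum_congr rfl fun j hj => ?_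
        have hj' := (mem_intPts' N d j).1 hj
        rw [lap_congr h (hE a ha) hj', hE b hb j (interior_grid hj')]
    _ = _ := this
    _ = _ := by
        refine Finset.sum_congr rfl fun j hj => ?_
        have hj' := (mem_intPts' N d j).1 hj
        rw [lap_congr h (hE b hb) hj', hE a ha j (interior_grid hj')]

/-- Equality case of the discrete best-response variational inequality (used in Step 3 of the
proof of Theorem 3.2): if `m ∈ T_{h,τ}` attains equality in the variational inequality, then
`m = m'` on `Γ(u)` and `m` solves the discrete Fokker–Planck equation wherever `u < 0`. -/
theorem discrete_best_response_equality_case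
    (d N K : ℕ) (hd : 1 ≤ d) (hN : 2 ≤ N) (hK : 1 ≤ K)
    (τ h : ℝ) (hτ : 0 < τ) (hh : h = 1 / (N : ℝ))
    (m0 : (Fin d → ℤ) → ℝ)
    (hm0nonneg : ∀ j : Fin d → ℤ, isGridPt N j → 0 ≤ m0 j)
    (hm0bd : ∀ j : Fin d → ℤ, isBoundary N j → m0 j = 0)
    (g : ℕ → (Fin d → ℤ) → ℝ) (u m' : ℕ → (Fin d → ℤ) → ℝ)
    (hu : solvesObstacle N K τ h g u)
    (hm'init : ∀ j : Fin d → ℤ, isGridPt N j → m' 0 j = m0 j)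
    (hm'bd : ∀ k ≤ K, ∀ j : Fin d → ℤ, isBoundary N j → m' k j = 0)
    (hm'fp : ∀ k, 1 ≤ k → k ≤ K → ∀ j : Fin d → ℤ, isInterior N j →
      (u k j < 0 → (m' k j - m' (k - 1) j) / τ - discLap h (m' k) j = 0) ∧
      (u k j = 0 → m' k j = 0))
    (m : ℕ → (Fin d → ℤ) → ℝ) (hm : inTestSet N K τ h m0 m)
    (heq : ∑ k ∈ Finset.range K, ∑ j ∈ intPts N d, g k j * (m' k j - m k j) = 0) :
    (∀ k < K, ∀ j : Fin d → ℤ, isInterior N j →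
      (u k j - u (k + 1) j) / τ - discLap h (u k) j - g k j < 0 → m k j = m' k j) ∧
    (∀ k, 1 ≤ k → k ≤ K → ∀ j : Fin d → ℤ, isInterior N j → u k j < 0 →
      (m k j - m (k - 1) j) / τ - discLap h (m k) j = 0) := by
  obtain ⟨hob, huK, hubd⟩ := hu
  obtain ⟨hmbd, hmnn, hmfp, hminit⟩ := hm
  set w : ℕ → (Fin d → ℤ) → ℝ := fun k j => m' k j - m k j with hw
  set A : ℕ → (Fin d → ℤ) → ℝ :=
    fun k j => (u k j - u (k + 1) j) / τ - discLap h (u k) j - g k j with hA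
  set P : ℕ → (Fin d → ℤ) → ℝ :=
    fun k j => u k j * ((w k j - w (k - 1) j) / τ - discLap h (w k) j) with hP
  have hw0 : ∀ j, isGridPt N j → w 0 j = 0 := fun j hj => by
    simp [hw, hm'init j hj, hminit j hj]
  have hu0 : ∀ k < K, ∀ j, isInterior N j → u k j ≤ 0 := fun k hk j hj => by
    rw [← hob k hk j hj]; exact le_max_right _ _
  have hA0 : ∀ k < K, ∀ j, isInterior N j → A k j ≤ 0 := fun k hk j hj => by
    rw [← hob k hk j hj]; exact le_max_left _ _
  have hAu : ∀ k < K, ∀ j, isInterior N j → A k j < 0 → u k j = 0 := fun k hk j hj hlt => by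
    have h1 := hob k hk j hj
    rcases max_choice (A k j) (u k j) with h2 | h2
    · have : A k j = 0 := h2.symm.trans h1
      linarith
    · exact h2.symm.trans h1
  -- signs
  have hPs : ∀ k < K, ∀ j, isInterior N j → P k j ≤ 0 := by
    intro k hk j hj
    rcases (hu0 k hk j hj).lt_or_eq with hlt | he
    · rcases Nat.eq_zero_or_pos k with rfl | hk1
      · have : discLap h (w 0) j = 0 := by
          rw [lap_congr (N := N) h (b := fun _ => 0) hw0 hj]; simp [discLap]
        simp [hP, this]
      · have h1 := (hm'fp k hk1 hk.le j hj).1 hlt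
        have h2 := hmfp k hk1 hk.le j hj
        have h3 : discLap h (w k) j = discLap h (m' k) j - discLap h (m k) j := lap_sub h _ _ j
        refine mul_nonpos_of_nonpos_of_nonneg hlt.le ?_
        have h4 : (w k j - w (k - 1) j) / τ - discLap h (w k) j =
          ((m' k j - m' (k - 1) j) / τ - discLap h (m' k) j)
            - ((m k j - m (k - 1) j) / τ - discLap h (m k) j) := by
          rw [h3]; simp only [hw]; ring
        rw [h4, h1]; linarith
    · simp [hP, he]
  have hAw : ∀ k < K, ∀ j, isInterior N j → 0 ≤ A k j * w k j := by
    intro k hk j hj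
    rcases (hA0 k hk j hj).lt_or_eq with hlt | he
    · rcases Nat.eq_zero_or_pos k with rfl | hk1
      · rw [hw0 j (interior_grid hj)]; simp
      · have h1 := (hm'fp k hk1 hk.le j hj).2 (hAu k hk j hj hlt)
        have h2 := hmnn k hk.le j (interior_grid hj)
        refine mul_nonneg_of_nonpos_of_nonpos hlt.le ?_
        simp only [hw]; linarith
    · simp [he]
  have hstep : ∀ k ∈ Finset.range K, ∑ j ∈ intPts N d, g k j * (m' k j - m k j) =
      ∑ j ∈ intPts N d, (P k j - A k j * w k j)
      - (∑ j ∈ intPts N d, u (k + 1) j * w (k + 1 - 1) j / τ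
        - ∑ j ∈ intPts N d, u k j * w (k - 1) j / τ) := by
    intro k hk
    have hk := Finset.mem_range.1 hk
    have hg := green (N := N) h (u k) (w k) (hubd k hk)
      (fun j hj => by simp [hw, hm'bd k hk.le j hj, hmbd k hk.le j hj])
    have e : ∑ j ∈ intPts N d, g k j * (m' k j - m k j) =
      ∑ j ∈ intPts N d, (P k j - A k j * w k j)
      - (∑ j ∈ intPts N d, u (k + 1) j * w (k + 1 - 1) j / τ
        - ∑ j ∈ intPts N d, u k j * w (k - 1) j / τ)
      - (∑ j ∈ intPts N d, discLap h (u k) j * w k j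
        - ∑ j ∈ intPts N d, u k j * discLap h (w k) j) := by
      simp only [← Finset.sum_sub_distrib]
      refine Finset.sum_congr rfl fun j _ => ?_
      simp only [hP, hA, Nat.add_sub_cancel]
      simp only [hw]
      ring
    rw [e, hg]; ring
  rw [Finset.sum_congr rfl hstep, Finset.sum_sub_distrib,
    Finset.sum_range_sub (fun k => ∑ j ∈ intPts N d, u k j * w (k - 1) j / τ)] at heq
  have q0 : ∑ j ∈ intPts N d, u 0 j * w (0 - 1) j / τ = 0 :=
    Finset.sum_eq_zero fun j hj => by
      rw [Nat.zero_sub, hw0 j (interior_grid ((mem_intPts' N d j).1 hj))]; simp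
  have qK : ∑ j ∈ intPts N d, u K j * w (K - 1) j / τ = 0 :=
    Finset.sum_eq_zero fun j hj => by
      rw [huK j (interior_grid ((mem_intPts' N d j).1 hj))]; simp
  rw [q0, qK, sub_zero, sub_zero] at heq
  have hterm : ∀ k < K, ∀ j, isInterior N j → P k j - A k j * w k j ≤ 0 := fun k hk j hj => by
    linarith [hPs k hk j hj, hAw k hk j hj]
  have hz : ∀ k < K, ∀ j, isInterior N j → P k j - A k j * w k j = 0 := by
    intro k hk j hj
    have h1 := (Finset.sum_eq_zero_iff_of_nonpos (fun k hk => Finset.sum_nonpos fun j hj =>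
      hterm k (Finset.mem_range.1 hk) j ((mem_intPts' N d j).1 hj))).1 heq k (Finset.mem_range.2 hk)
    exact (Finset.sum_eq_zero_iff_of_nonpos (fun j hj =>
      hterm k hk j ((mem_intPts' N d j).1 hj))).1 h1 j ((mem_intPts' N d j).2 hj)
  refine ⟨fun k hk j hj hlt => ?_, fun k hk1 hkK j hj hlt => ?_⟩
  · have h1 : A k j * w k j = 0 := by
      linarith [hPs k hk j hj, hAw k hk j hj, hz k hk j hj]
    have h2 : w k j = 0 := (mul_eq_zero.1 h1).resolve_left (ne_of_lt hlt)
    simp only [hw] at h2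
    linarith
  · have hk : k < K := by
      rcases hkK.lt_or_eq with h1 | rfl
      · exact h1
      · rw [huK j (interior_grid hj)] at hlt; exact absurd hlt (lt_irrefl _)
    have h1 : P k j = 0 := by
      linarith [hPs k hk j hj, hAw k hk j hj, hz k hk j hj]
    have h2 := (mul_eq_zero.1 h1).resolve_left (ne_of_lt hlt)
    have h3 : discLap h (w k) j = discLap h (m' k) j - discLap h (m k) j := lap_sub h _ _ j
    have h4 := (hm'fp k hk1 hk.le j hj).1 hlt
    have h5 : (w k j - w (k - 1) j) / τ - discLap h (w k) j =
      ((m' k j - m' (k - 1) j) / τ - discLap h (m' k) j)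
        - ((m k j - m (k - 1) j) / τ - discLap h (m k) j) := by
      rw [h3]; simp only [hw]; ring
    linarith
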